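/- arXiv:math/0402267 — 2 statements merged into one kernel-verified Lean document; each statement's English description precedes it below -/
import Mathlib

section
/- For every natural number n ≥ 1, the map from the n-th symmetric product Sym^n(ℂ) to ℂ^n that sends the class of a tuple (z_1, …, z_n) to the n-tuple whose j-th entry (1 ≤ j ≤ n) is the j-th elementary symmetric polynomial e_j(z_1, …, z_n) is a homeomorphism. (Equivalently: sending an unordered n-tuple of complex numbers to the non-leading coefficients of the monic polynomial ∏_{i=1}^n (X − z_i) is a homeomorphism onto ℂ^n.) -/
/-- The setoid on `Fin n → X` identifying tuples that differ by a permutation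
of the coordinates (the permutation action of the symmetric group `Σ_n`). -/
def permSetoid (n : ℕ) (X : Type*) : Setoid (Fin n → X) where
  r f g := ∃ σ : Equiv.Perm (Fin n), f ∘ σ = g
  iseqv := by
    refine ⟨fun f => ⟨Equiv.refl _, rfl⟩, ?_, ?_⟩
    · rintro f g ⟨σ, rfl⟩
      exact ⟨σ.symm, by ext i; simp⟩
    · rintro f g h ⟨σ, rfl⟩ ⟨τ, rfl⟩
      exact ⟨τ.trans σ, rfl⟩

/-- The `n`-th symmetric product of `X`: the quotient of `X^n` by the
permutation action of the symmetric group `Σ_n`, with the quotient topology. -/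
def SymProd (n : ℕ) (X : Type*) : Type _ := Quotient (permSetoid n X)

instance (n : ℕ) (X : Type*) [TopologicalSpace X] : TopologicalSpace (SymProd n X) :=
  inferInstanceAs (TopologicalSpace (Quotient (permSetoid n X)))

/-- The class of a tuple in the symmetric product. -/
def SymProd.mk {n : ℕ} {X : Type*} (f : Fin n → X) : SymProd n X :=
  Quotient.mk (permSetoid n X) f

/-- The tuple `(e_1(f), …, e_n(f))` of elementary symmetric polynomials of a tuple `f`. -/
def esymmTuple {R : Type*} [CommRing R] {n : ℕ} (f : Fin n → R) (j : Fin n) : R :=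
  (Multiset.map f Finset.univ.val).esymm ((j : ℕ) + 1)

/-- Two tuples with the same multiset of values differ by a permutation of the coordinates. -/
theorem exists_perm_comp_eq_of_map_univ_eq {ι X : Type*} [Fintype ι] {f g : ι → X}
    (h : Multiset.map f Finset.univ.val = Multiset.map g Finset.univ.val) :
    ∃ σ : Equiv.Perm ι, f ∘ σ = g := by
  classical
  have hcard (c : X) : Fintype.card {i // g i = c} = Fintype.card {i // f i = c} := by
    have hc := congrArg (Multiset.count c) h
    simp only [Multiset.count_map, eq_comm (a := c)] at hc
    rw [Fintype.card_subtype, Fintype.card_subtype]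
    exact hc.symm
  exact ⟨Equiv.ofFiberEquiv fun c => Fintype.equivOfCardEq (hcard c),
    funext fun i => Equiv.ofFiberEquiv_map _ i⟩

/-- Every multiset of cardinality `n` is the multiset of values of an `n`-tuple. -/
theorem Multiset.exists_map_univ_fin_eq {X : Type*} {n : ℕ} (s : Multiset X)
    (hs : s.card = n) : ∃ f : Fin n → X, Multiset.map f Finset.univ.val = s := by
  subst hs
  induction s using Quotient.inductionOn with
  | h l =>
    refine ⟨l.get, ?_⟩
    exact (Fin.univ_val_map l.get).trans (congrArg _ (List.ofFn_get l))

section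

open Polynomial

theorem coeff_prod_X_sub_C_eq_esymmTuple {R : Type*} [CommRing R] {n : ℕ} (f : Fin n → R)
    (j : Fin n) :
    ((Multiset.map f Finset.univ.val).map fun t => X - C t).prod.coeff (n - (j + 1)) =
      (-1) ^ ((j : ℕ) + 1) * esymmTuple f j := by
  have hcard : (Multiset.map f Finset.univ.val).card = n := by simp
  rw [Multiset.prod_X_sub_C_coeff _ (by rw [hcard]; exact Nat.sub_le _ _), hcard,
    Nat.sub_sub_self j.2, esymmTuple]

theorem natDegree_prod_X_sub_C_map_univ {R : Type*} [CommRing R] [Nontrivial R] {n : ℕ}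
    (f : Fin n → R) :
    ((Multiset.map f Finset.univ.val).map fun t => X - C t).prod.natDegree = n := by
  rw [natDegree_multiset_prod_X_sub_C_eq_card]
  simp

theorem map_univ_eq_of_esymmTuple_eq {R : Type*} [CommRing R] [IsDomain R] {n : ℕ}
    {f g : Fin n → R} (h : esymmTuple f = esymmTuple g) :
    Multiset.map f Finset.univ.val = Multiset.map g Finset.univ.val := by
  rw [← roots_multiset_prod_X_sub_C (Multiset.map f Finset.univ.val),
    ← roots_multiset_prod_X_sub_C (Multiset.map g Finset.univ.val)]
  congr 1
  have hmonic (u : Fin n → R) :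
      ((Multiset.map u Finset.univ.val).map fun t => X - C t).prod.coeff n = 1 := by
    have := monic_multiset_prod_of_monic (Multiset.map u Finset.univ.val) (fun t => X - C t)
      fun t _ => monic_X_sub_C t
    rwa [Monic, leadingCoeff, natDegree_prod_X_sub_C_map_univ] at this
  ext k
  rcases lt_trichotomy k n with hk | rfl | hk
  · have hf := coeff_prod_X_sub_C_eq_esymmTuple f ⟨n - (k + 1), by omega⟩
    have hg := coeff_prod_X_sub_C_eq_esymmTuple g ⟨n - (k + 1), by omega⟩
    rw [show n - (n - (k + 1) + 1) = k by omega] at hf hg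
    rw [hf, hg, h]
  · rw [hmonic f, hmonic g]
  · rw [coeff_eq_zero_of_natDegree_lt (by rwa [natDegree_prod_X_sub_C_map_univ]),
      coeff_eq_zero_of_natDegree_lt (by rwa [natDegree_prod_X_sub_C_map_univ])]

theorem esymmTuple_surjective {K : Type*} [Field K] [IsAlgClosed K] (n : ℕ) :
    Function.Surjective (esymmTuple : (Fin n → K) → Fin n → K) := by
  intro c
  let q : K[X] := ∑ i : Fin n, C ((-1) ^ ((i : ℕ) + 1) * c i) * X ^ (n - (i + 1))
  have hq : q.degree < n := by
    refine (degree_sum_le _ _).trans_lt ((Finset.sup_lt_iff (WithBot.bot_lt_coe n)).2 fun i _ =>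
      (degree_C_mul_X_pow_le _ _).trans_lt ?_)
    have := i.2
    exact Nat.cast_lt.2 (by omega)
  have hmonic : (X ^ n + q).Monic := monic_X_pow_add hq
  have hdeg : (X ^ n + q).natDegree = n := by
    rw [natDegree_eq_of_degree_eq (degree_add_eq_left_of_degree_lt (hq.trans_eq (degree_X_pow n).symm)), natDegree_X_pow]
  have hsplits : (X ^ n + q).Splits := IsAlgClosed.splits _
  have hroots : (X ^ n + q).roots.card = n := by
    rw [← hsplits.natDegree_eq_card_roots, hdeg]
  obtain ⟨f, hf⟩ := Multiset.exists_map_univ_fin_eq _ hroots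
  refine ⟨f, funext fun j => ?_⟩
  have hcoeff := coeff_prod_X_sub_C_eq_esymmTuple f j
  rw [hf, prod_multiset_X_sub_C_of_monic_of_roots_card_eq hmonic (by rw [hroots, hdeg])] at hcoeff
  have hj := j.2
  have hqj : q.coeff (n - (j + 1)) = (-1) ^ ((j : ℕ) + 1) * c j := by
    simp only [q, finsetSum_coeff, coeff_C_mul_X_pow]
    rw [Finset.sum_eq_single j]
    · simp
    · intro i _ hij
      have := Fin.val_ne_of_ne hij
      exact if_neg (by omega)
    · simp
  rw [coeff_add, coeff_X_pow, if_neg (by omega), zero_add, hqj] at hcoeff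
  exact (mul_left_cancel₀ (pow_ne_zero _ (neg_ne_zero.2 one_ne_zero)) hcoeff).symm

theorem norm_le_of_norm_esymmTuple_le {K : Type*} [NormedField K] {n : ℕ} {f : Fin n → K}
    {r : ℝ} (hr : ‖esymmTuple f‖ ≤ r) : ‖f‖ ≤ r + 1 := by
  have hr0 : 0 ≤ r := (norm_nonneg _).trans hr
  refine (pi_norm_le_iff_of_nonneg (by positivity)).2 fun i => ?_
  set p := ((Multiset.map f Finset.univ.val).map fun t => X - C t).prod with hp
  have hmonic : p.Monic := monic_multiset_prod_of_monic _ _ fun t _ => monic_X_sub_C t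
  have hroot : p.IsRoot (f i) := by
    rw [← mem_roots hmonic.ne_zero, hp, roots_multiset_prod_X_sub_C]
    exact Multiset.mem_map_of_mem f (Finset.mem_univ i)
  have hlt := IsRoot.norm_lt_cauchyBound hmonic.ne_zero hroot
  lift r to NNReal using hr0
  have hbound : p.cauchyBound ≤ r + 1 := by
    rw [cauchyBound, hmonic.leadingCoeff, nnnorm_one, div_one, hp,
      natDegree_prod_X_sub_C_map_univ]
    gcongr
    refine Finset.sup_le fun k hk => ?_
    have hk' := Finset.mem_range.1 hk
    have hcoeff := coeff_prod_X_sub_C_eq_esymmTuple f ⟨n - (k + 1), by omega⟩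
    rw [show n - (n - (k + 1) + 1) = k by omega] at hcoeff
    rw [hcoeff, nnnorm_mul, nnnorm_pow, nnnorm_neg, nnnorm_one, one_pow, one_mul]
    exact (nnnorm_le_pi_nnnorm _ _).trans hr
  exact_mod_cast hlt.le.trans hbound

end

theorem continuous_esymmTuple {R : Type*} [CommRing R] [TopologicalSpace R]
    [IsTopologicalRing R] (n : ℕ) : Continuous (esymmTuple : (Fin n → R) → Fin n → R) := by
  unfold esymmTuple
  simp only [Finset.esymm_map_val]
  fun_prop

theorem isProperMap_esymmTuple {K : Type*} [NormedField K] [ProperSpace K] (n : ℕ) :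
    IsProperMap (esymmTuple : (Fin n → K) → Fin n → K) := by
  refine isProperMap_iff_isCompact_preimage.2 ⟨continuous_esymmTuple n, fun s hs => ?_⟩
  refine Metric.isCompact_of_isClosed_isBounded
    (hs.isClosed.preimage (continuous_esymmTuple n)) ?_
  obtain ⟨r, hr⟩ := hs.isBounded.exists_norm_le
  exact isBounded_iff_forall_norm_le.2
    ⟨r + 1, fun f hf => norm_le_of_norm_esymmTuple_le (hr _ hf)⟩

/-- The map induced by `esymmTuple` on the symmetric product. -/
def SymProd.esymm {R : Type*} [CommRing R] {n : ℕ} : SymProd n R → Fin n → R :=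
  Quotient.lift esymmTuple (by
    rintro f _ ⟨σ, rfl⟩
    funext j
    rw [esymmTuple, esymmTuple, ← Multiset.map_map, Multiset.map_univ_val_equiv])

theorem SymProd.esymm_injective {R : Type*} [CommRing R] [IsDomain R] {n : ℕ} :
    Function.Injective (SymProd.esymm : SymProd n R → Fin n → R) := by
  intro a b
  refine Quotient.inductionOn₂ a b fun f g h => Quotient.sound ?_
  exact exists_perm_comp_eq_of_map_univ_eq (map_univ_eq_of_esymmTuple_eq h)

theorem SymProd.isHomeomorph_esymm {K : Type*} [NormedField K] [ProperSpace K] [IsAlgClosed K]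
    (n : ℕ) : IsHomeomorph (SymProd.esymm : SymProd n K → Fin n → K) := by
  have hquot : Topology.IsQuotientMap (SymProd.esymm ∘ SymProd.mk : (Fin n → K) → Fin n → K) :=
    (isProperMap_esymmTuple n).isClosedMap.isQuotientMap (continuous_esymmTuple n)
      (esymmTuple_surjective n)
  exact isHomeomorph_iff_isQuotientMap_injective.2
    ⟨.of_comp continuous_quotient_mk' ((continuous_esymmTuple n).quotient_lift _) hquot,
      SymProd.esymm_injective⟩


/-- For `n ≥ 1`, the map `Sym^n(ℂ) → ℂ^n` sending the class of a tuple
`(z_1, …, z_n)` to the tuple of its elementary symmetric polynomials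
(the `j`-th entry, for `j : Fin n`, being `e_{j+1}(z_1, …, z_n)`, i.e. the
non-leading coefficients of `∏ (X - z_i)` up to sign) is a homeomorphism. -/
theorem symProd_complex_homeomorph_via_esymm (n : ℕ) (hn : 1 ≤ n) :
    ∃ e : SymProd n ℂ ≃ₜ (Fin n → ℂ),
      ∀ f : Fin n → ℂ,
        e (SymProd.mk f) =
          fun j : Fin n => (Multiset.map f Finset.univ.val).esymm ((j : ℕ) + 1) := by
  exact ⟨(SymProd.isHomeomorph_esymm n).homeomorph _, fun _ => rfl⟩
end

section
/- For every natural number n ≥ 1, the map μ : Sym^n(S^1) → S^1 sending the class of an n-tuple (z_1, …, z_n) of points of the circle to the product z_1 ⋯ z_n (multiplication in the circle group) is a homotopy equivalence. In particular the n-th symmetric product of the circle is homotopy equivalent to the circle for all n ≥ 1. -/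
namespace SymProd

section General

variable {n : ℕ} {X : Type*}

theorem mk_eq_mk_iff {f g : Fin n → X} :
    mk f = mk g ↔ ∃ σ : Equiv.Perm (Fin n), f ∘ σ = g :=
  Quotient.eq (r := permSetoid n X)

theorem mk_surjective : Function.Surjective (mk : (Fin n → X) → SymProd n X) :=
  Quotient.mk_surjective

theorem isQuotientMap_mk [TopologicalSpace X] :
    Topology.IsQuotientMap (mk : (Fin n → X) → SymProd n X) :=
  isQuotientMap_quot_mk

/-- The quotient map to the symmetric product is closed, as the symmetric group is finite. -/
theorem isClosedMap_mk [TopologicalSpace X] :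
    IsClosedMap (mk : (Fin n → X) → SymProd n X) := by
  intro C hC
  rw [← isQuotientMap_mk.isClosed_preimage]
  have h : (mk : (Fin n → X) → SymProd n X) ⁻¹' (mk '' C) =
      ⋃ σ : Equiv.Perm (Fin n), (fun f : Fin n → X => f ∘ σ) ⁻¹' C := by
    ext f
    simp only [Set.mem_preimage, Set.mem_image, Set.mem_iUnion]
    constructor
    · rintro ⟨g, hg, hgf⟩
      obtain ⟨σ, rfl⟩ := mk_eq_mk_iff.1 hgf.symm
      exact ⟨σ, hg⟩
    · rintro ⟨σ, hσ⟩
      exact ⟨_, hσ, (mk_eq_mk_iff.2 ⟨σ, rfl⟩).symm⟩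
  rw [h]
  refine isClosed_iUnion_of_finite fun σ => hC.preimage ?_
  exact continuous_pi fun i => continuous_apply (σ i)

/-- The product of the entries of an unordered tuple. -/
def prod [CommMonoid X] : SymProd n X → X :=
  Quotient.lift (fun f : Fin n → X => ∏ i, f i) <| by
    rintro f g ⟨σ, rfl⟩
    exact (Equiv.prod_comp σ f).symm

@[simp]
theorem prod_mk [CommMonoid X] (f : Fin n → X) : prod (mk f) = ∏ i, f i := rfl

theorem continuous_prod [CommMonoid X] [TopologicalSpace X] [ContinuousMul X] :
    Continuous (prod : SymProd n X → X) :=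
  isQuotientMap_mk.continuous_iff.2 <|
    continuous_finsetProd Finset.univ fun i _ => continuous_apply i

end General

variable {m : ℕ}

/-- The class in the symmetric product of the circle of a tuple of angles. -/
noncomputable def ofAngles {n : ℕ} (x : Fin n → ℝ) : SymProd n Circle :=
  mk fun i => Circle.exp (x i)

theorem continuous_ofAngles {n : ℕ} :
    Continuous (ofAngles : (Fin n → ℝ) → SymProd n Circle) :=
  isQuotientMap_mk.continuous.comp <|
    continuous_pi fun i => Circle.exp.continuous.comp (continuous_apply i)

theorem prod_ofAngles {n : ℕ} (x : Fin n → ℝ) : prod (ofAngles x) = Circle.exp (∑ i, x i) := by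
  have h (s : Finset (Fin n)) : ∏ i ∈ s, Circle.exp (x i) = Circle.exp (∑ i ∈ s, x i) := by
    induction s using Finset.cons_induction with
    | empty => simp
    | cons a s ha ih => rw [Finset.prod_cons, Finset.sum_cons, Circle.exp_add, ih]
  exact h _

/-- Replace the first angle `x 0` by `x 0 + 2π`, moved to the last position. -/
noncomputable def rotate (x : Fin (m + 1) → ℝ) : Fin (m + 1) → ℝ :=
  Fin.snoc (α := fun _ => ℝ) (Fin.tail x) (x 0 + 2 * Real.pi)

@[simp]
theorem rotate_castSucc (x : Fin (m + 1) → ℝ) (i : Fin m) : rotate x i.castSucc = x i.succ := by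
  simp [rotate, Fin.tail]

@[simp]
theorem rotate_last (x : Fin (m + 1) → ℝ) : rotate x (Fin.last m) = x 0 + 2 * Real.pi := by
  simp [rotate]

theorem sum_rotate (x : Fin (m + 1) → ℝ) : ∑ i, rotate x i = (∑ i, x i) + 2 * Real.pi := by
  rw [Fin.sum_univ_castSucc, Fin.sum_univ_succ x]
  simp only [rotate_castSucc, rotate_last]
  ring

theorem ofAngles_rotate (x : Fin (m + 1) → ℝ) : ofAngles (rotate x) = ofAngles x := by
  refine (mk_eq_mk_iff.2 ⟨finRotate (m + 1), ?_⟩).symm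
  ext1 i
  induction i using Fin.lastCases with
  | last => simp [Circle.periodic_exp (x 0)]
  | cast i => simp

/-- Straight-line motion from a tuple of angles to the equally spaced tuple with the same sum. -/
noncomputable def spread (t : ℝ) (x : Fin (m + 1) → ℝ) : Fin (m + 1) → ℝ := fun i =>
  (1 - t) * x i + t * ((∑ j, x j) / (m + 1) + 2 * Real.pi * (i - m / 2) / (m + 1))

theorem continuous_spread :
    Continuous fun p : ℝ × (Fin (m + 1) → ℝ) => spread p.1 p.2 := by
  unfold spread
  fun_prop

@[simp]
theorem spread_zero (x : Fin (m + 1) → ℝ) : spread 0 x = x := by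
  ext i
  simp [spread]

theorem sum_spread (t : ℝ) (x : Fin (m + 1) → ℝ) : ∑ i, spread t x i = ∑ i, x i := by
  have h : ∑ i : Fin (m + 1), ((i : ℕ) : ℝ) = m * (m + 1) / 2 := by
    rw [Fin.sum_univ_eq_sum_range (fun i => (i : ℝ))]
    induction m with
    | zero => simp
    | succ k ih =>
      rw [Finset.sum_range_succ, ih (fun _ => 0)]
      push_cast
      ring
  have hm : (m : ℝ) + 1 ≠ 0 := by positivity
  simp only [spread, Finset.sum_add_distrib, ← Finset.mul_sum, ← Finset.sum_div,
    Finset.sum_sub_distrib, h, Finset.sum_const, Finset.card_univ, Fintype.card_fin, nsmul_eq_mul]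
  push_cast
  field_simp
  ring

theorem spread_rotate (t : ℝ) (x : Fin (m + 1) → ℝ) :
    spread t (rotate x) = rotate (spread t x) := by
  have hm : (m : ℝ) + 1 ≠ 0 := by positivity
  ext i
  induction i using Fin.lastCases with
  | last =>
    simp only [spread, rotate_last, sum_rotate, Fin.val_last, Fin.val_zero]
    push_cast
    field_simp
    ring
  | cast i =>
    simp only [spread, rotate_castSucc, sum_rotate, Fin.val_castSucc, Fin.val_succ]
    push_cast
    field_simp
    ring

theorem ofAngles_spread_one_eq_of_exp_sum_eq {x y : Fin (m + 1) → ℝ}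
    (h : Circle.exp (∑ i, x i) = Circle.exp (∑ i, y i)) :
    ofAngles (spread 1 x) = ofAngles (spread 1 y) := by
  let c (s : ℝ) : Fin (m + 1) → ℝ := Fin.cons (α := fun _ => ℝ) s 0
  have hc (s : ℝ) : ∑ i, c s i = s := by simp [c, Fin.sum_univ_succ]
  have hs {x y : Fin (m + 1) → ℝ} (h : ∑ i, x i = ∑ i, y i) : spread 1 x = spread 1 y := by
    ext i
    simp [spread, h]
  have hper : Function.Periodic (fun s => ofAngles (spread 1 (c s))) (2 * Real.pi) := fun s => by
    dsimp only
    rw [hs (y := rotate (c s)) (by rw [sum_rotate, hc, hc]), spread_rotate, ofAngles_rotate]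
  obtain ⟨k, hk⟩ := Circle.exp_eq_exp.1 h
  rw [hs (hc (∑ i, x i)).symm, hs (hc (∑ i, y i)).symm, hk]
  exact hper.int_mul k _

/-- Weakly increasing tuples of angles in `[-π, π]`. -/
def sortedAngles (n : ℕ) : Set (Fin n → ℝ) :=
  {x | Monotone x} ∩ Set.univ.pi fun _ => Set.Icc (-Real.pi) Real.pi

theorem isCompact_sortedAngles (n : ℕ) : IsCompact (sortedAngles n) := by
  refine (isCompact_univ_pi fun _ => isCompact_Icc).inter_left ?_
  simp only [Monotone, Set.ofPred_forall]
  exact isClosed_iInter fun i => isClosed_iInter fun j => isClosed_iInter fun _ =>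
    isClosed_le (continuous_apply i) (continuous_apply j)

theorem rotate_mem_sortedAngles {x : Fin (m + 1) → ℝ} (hx : x ∈ sortedAngles (m + 1))
    (h0 : x 0 = -Real.pi) : rotate x ∈ sortedAngles (m + 1) := by
  have hlast : rotate x (Fin.last m) = Real.pi := by
    rw [rotate_last, h0]
    ring
  have hmem (i) : rotate x i ∈ Set.Icc (-Real.pi) Real.pi := by
    induction i using Fin.lastCases with
    | last => rw [hlast]; exact ⟨by linarith [Real.pi_pos], le_rfl⟩
    | cast i => rw [rotate_castSucc]; exact hx.2 _ trivial
  refine ⟨fun i j hij => ?_, fun i _ => hmem i⟩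
  induction j using Fin.lastCases with
  | last => rw [hlast]; exact (hmem i).2
  | cast j =>
    induction i using Fin.lastCases with
    | last => exact absurd hij (not_le.2 (Fin.castSucc_lt_last j))
    | cast i =>
      rw [rotate_castSucc, rotate_castSucc]
      exact hx.1 (Fin.succ_le_succ_iff.2 (Fin.castSucc_le_castSucc_iff.1 hij))

/-- Every sorted tuple of angles can be rotated to one with all angles in `(-π, π]`. -/
theorem exists_sortedAngles_Ioc {x : Fin (m + 1) → ℝ} (hx : x ∈ sortedAngles (m + 1)) :
    ∃ y ∈ sortedAngles (m + 1), (∀ i, -Real.pi < y i) ∧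
      ∀ t, ofAngles (spread t y) = ofAngles (spread t x) := by
  obtain ⟨k, hk⟩ : ∃ k : ℕ, (m + 1) * Real.pi - ∑ i, x i < k * (2 * Real.pi) := by
    obtain ⟨k, hk⟩ := exists_nat_gt (((m + 1) * Real.pi - ∑ i, x i) / (2 * Real.pi))
    exact ⟨k, (div_lt_iff₀ Real.two_pi_pos).1 hk⟩
  induction k generalizing x with
  | zero =>
    have h : ∑ i, x i ≤ ∑ _i : Fin (m + 1), Real.pi :=
      Finset.sum_le_sum fun i _ => (hx.2 i trivial).2
    simp at hk h
    linarith
  | succ k ih =>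
    rcases (hx.2 0 trivial).1.eq_or_lt with h0 | h0
    · obtain ⟨y, hy, hlt, hyx⟩ := ih (rotate_mem_sortedAngles hx h0.symm) (by
        rw [sum_rotate]
        push_cast at hk
        linarith)
      exact ⟨y, hy, hlt, fun t => by rw [hyx, spread_rotate, ofAngles_rotate]⟩
    · exact ⟨x, hx, fun i => h0.trans_le (hx.1 (Fin.zero_le i)), fun _ => rfl⟩

theorem eq_of_ofAngles_eq {n : ℕ} {x y : Fin n → ℝ} (hx : x ∈ sortedAngles n)
    (hy : y ∈ sortedAngles n) (hx' : ∀ i, -Real.pi < x i) (hy' : ∀ i, -Real.pi < y i)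
    (h : ofAngles x = ofAngles y) : x = y := by
  obtain ⟨σ, hσ⟩ := mk_eq_mk_iff.1 h
  have hxy : x ∘ σ = y := by
    ext i
    have := congrArg (fun z : Circle => Complex.arg z) (congrFun hσ i)
    simpa only [Function.comp_apply, Circle.arg_exp (hx' _) (hx.2 _ trivial).2,
      Circle.arg_exp (hy' _) (hy.2 _ trivial).2] using this
  have := Tuple.unique_monotone (f := x) (σ := σ) (τ := 1) (by rw [hxy]; exact hy.1) hx.1
  rw [← hxy, this]
  rfl

theorem ofAngles_spread_eq {x y : Fin (m + 1) → ℝ} (hx : x ∈ sortedAngles (m + 1))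
    (hy : y ∈ sortedAngles (m + 1)) (h : ofAngles x = ofAngles y) (t : ℝ) :
    ofAngles (spread t x) = ofAngles (spread t y) := by
  obtain ⟨x', hx', hlt, hxx⟩ := exists_sortedAngles_Ioc hx
  obtain ⟨y', hy', hlt', hyy⟩ := exists_sortedAngles_Ioc hy
  have hxx0 := hxx 0
  have hyy0 := hyy 0
  rw [spread_zero, spread_zero] at hxx0 hyy0
  have hxy := eq_of_ofAngles_eq hx' hy' hlt hlt' (hxx0.trans (h.trans hyy0.symm))
  rw [← hxx, ← hyy, hxy]

theorem exists_sortedAngles_ofAngles_eq {n : ℕ} (a : SymProd n Circle) :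
    ∃ x ∈ sortedAngles n, ofAngles x = a := by
  obtain ⟨f, rfl⟩ := mk_surjective a
  let x : Fin n → ℝ := fun i => Complex.arg (f i)
  refine ⟨x ∘ Tuple.sort x, ⟨Tuple.monotone_sort x, fun i _ => ?_⟩,
    (mk_eq_mk_iff.2 ⟨Tuple.sort x, ?_⟩).symm⟩
  · exact ⟨(Complex.neg_pi_lt_arg _).le, Complex.arg_le_pi _⟩
  · ext1 i
    simp [x]

theorem isQuotientMap_ofAngles_restrict (n : ℕ) :
    Topology.IsQuotientMap fun x : sortedAngles n => ofAngles x.1 := by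
  have := isCompact_iff_compactSpace.1 (isCompact_sortedAngles n)
  have he : Continuous fun (x : sortedAngles n) (i : Fin n) => Circle.exp (x.1 i) :=
    continuous_pi fun i =>
      Circle.exp.continuous.comp ((continuous_apply i).comp continuous_subtype_val)
  refine IsClosedMap.isQuotientMap (isClosedMap_mk.comp he.isClosedMap)
    (continuous_ofAngles.comp continuous_subtype_val) fun a => ?_
  obtain ⟨x, hx, rfl⟩ := exists_sortedAngles_ofAngles_eq a
  exact ⟨⟨x, hx⟩, rfl⟩

/-- A motion of the symmetric product of the circle along the fibres of `prod`, starting at the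
identity and ending at a map which is constant on these fibres. -/
theorem exists_fibrewise_homotopy (m : ℕ) :
    ∃ H : C(unitInterval × SymProd (m + 1) Circle, SymProd (m + 1) Circle),
      (∀ a, H (0, a) = a) ∧ (∀ t a, prod (H (t, a)) = prod a) ∧
      ∀ a b, prod a = prod b → H (1, a) = H (1, b) := by
  choose r hr hra using exists_sortedAngles_ofAngles_eq (n := m + 1)
  have hH (t : ℝ) (x) (hx : x ∈ sortedAngles (m + 1)) :
      ofAngles (spread t (r (ofAngles x))) = ofAngles (spread t x) :=
    ofAngles_spread_eq (hr _) hx (hra _) t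
  let K : C(sortedAngles (m + 1) × unitInterval, SymProd (m + 1) Circle) :=
    ⟨fun p => ofAngles (spread p.2 p.1.1), continuous_ofAngles.comp <|
      continuous_spread.comp (f := fun p : sortedAngles (m + 1) × unitInterval =>
        ((p.2 : ℝ), p.1.1)) (by fun_prop)⟩
  have hcont : Continuous fun a : SymProd (m + 1) Circle => K.curry ⟨r a, hr a⟩ := by
    rw [(isQuotientMap_ofAngles_restrict (m + 1)).continuous_iff]
    convert K.curry.continuous using 1
    ext x t
    exact hH t x.1 x.2
  refine ⟨⟨fun p => ofAngles (spread p.1 (r p.2)), ?_⟩, fun a => ?_, fun t a => ?_,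
    fun a b hab => ?_⟩
  · exact (ContinuousMap.continuous_uncurry_of_continuous ⟨_, hcont⟩).comp continuous_swap
  · change ofAngles (spread 0 (r a)) = a
    rw [spread_zero, hra]
  · change prod (ofAngles (spread t (r a))) = prod a
    rw [prod_ofAngles, sum_spread, ← prod_ofAngles, hra]
  · refine ofAngles_spread_one_eq_of_exp_sum_eq ?_
    rw [← prod_ofAngles, ← prod_ofAngles, hra, hra, hab]

end SymProd

/-- For `n ≥ 1`, the map `μ : Sym^n(S^1) → S^1` sending the class of an
`n`-tuple of points of the circle to their product (in the circle group) is a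
homotopy equivalence; in particular `Sym^n(S^1)` is homotopy equivalent to the
circle. -/
theorem symProd_circle_product_homotopyEquiv (n : ℕ) (hn : 1 ≤ n) :
    ∃ h : ContinuousMap.HomotopyEquiv (SymProd n Circle) Circle,
      ∀ f : Fin n → Circle, h.toFun (SymProd.mk f) = ∏ i, f i := by
  obtain ⟨m, rfl⟩ : ∃ m, n = m + 1 := ⟨n - 1, by omega⟩
  obtain ⟨H, h0, hprod, h1⟩ := SymProd.exists_fibrewise_homotopy m
  let s : C(Circle, SymProd (m + 1) Circle) :=
    ⟨fun z => SymProd.mk (Fin.cons (α := fun _ => Circle) z 1),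
      SymProd.isQuotientMap_mk.continuous.comp
        (continuous_id.finCons (A := fun _ => Circle) continuous_const)⟩
  have hs (z : Circle) : SymProd.prod (s z) = z := by simp [s, Fin.prod_univ_succ]
  let μ : C(SymProd (m + 1) Circle, Circle) := ⟨SymProd.prod, SymProd.continuous_prod⟩
  let g : C(Circle, SymProd (m + 1) Circle) :=
    ⟨fun z => H (1, s z), H.continuous.comp (by fun_prop)⟩
  refine ⟨⟨μ, g, ⟨ContinuousMap.Homotopy.symm ⟨H, h0, fun a => ?_⟩⟩, ?_⟩, fun f => rfl⟩
  · exact h1 _ _ (hs _).symm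
  · have : μ.comp g = ContinuousMap.id Circle := by
      ext1 z
      exact (hprod _ _).trans (hs z)
    rw [this]
end
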